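/- arXiv:0712.1597 — 3 statements merged into one kernel-verified Lean document; each statement's English description precedes it below -/
import Mathlib

section
/- Let a ∈ ℤ and let V and V′ be e(2)-modules, each generated by a single weight vector of weight a (i.e. there is u ∈ V_a, u ≠ 0, such that the only submodule of V containing u is V itself, and similarly for V′). If dim_ℂ V_k = dim_ℂ V′_k for all k ∈ ℤ, then V and V′ are isomorphic as e(2)-modules. -/
/-- An `e(2)`-module: a finite-dimensional complex vector space `V` with endomorphisms
`Pp = P₊`, `Pm = P₋`, `L` satisfying `P₊∘P₋ = P₋∘P₊`, `L∘P₊ − P₊∘L = P₊`,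
`L∘P₋ − P₋∘L = −P₋`, such that `V` is the internal direct sum of the eigenspaces
`V_k = ker (L − k·id)`, `k ∈ ℤ`. -/
structure E2Mod : Type 1 where
  V : Type
  [acg : AddCommGroup V]
  [mod : Module ℂ V]
  [fd : FiniteDimensional ℂ V]
  Pp : V →ₗ[ℂ] V
  Pm : V →ₗ[ℂ] V
  L : V →ₗ[ℂ] V
  comm : Pp.comp Pm = Pm.comp Pp
  relp : L.comp Pp - Pp.comp L = Pp
  relm : L.comp Pm - Pm.comp L = -Pm
  internal : DirectSum.IsInternal fun k : ℤ =>
    LinearMap.ker (L - (k : ℂ) • (LinearMap.id : V →ₗ[ℂ] V))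

attribute [instance] E2Mod.acg E2Mod.mod E2Mod.fd

namespace E2Mod

/-- The `k`-weight space `V_k = ker (L - k·id)`. -/
def wt (M : E2Mod) (k : ℤ) : Submodule ℂ M.V :=
  LinearMap.ker (M.L - (k : ℂ) • (LinearMap.id : M.V →ₗ[ℂ] M.V))

/-- A subspace is a submodule if it is invariant under `P₊`, `P₋` and `L`. -/
def IsSubmod (M : E2Mod) (S : Submodule ℂ M.V) : Prop :=
  (∀ v ∈ S, M.Pp v ∈ S) ∧ (∀ v ∈ S, M.Pm v ∈ S) ∧ (∀ v ∈ S, M.L v ∈ S)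

/-- An `e(2)`-module is indecomposable if it is nonzero and admits no nontrivial
decomposition as an internal direct sum of two submodules. -/
def Indecomposable (M : E2Mod) : Prop :=
  (∃ v : M.V, v ≠ 0) ∧
    ∀ W₁ W₂ : Submodule ℂ M.V, M.IsSubmod W₁ → M.IsSubmod W₂ →
      W₁ ⊓ W₂ = ⊥ → W₁ ⊔ W₂ = ⊤ → W₁ = ⊥ ∨ W₂ = ⊥

/-- Isomorphism of `e(2)`-modules: a bijective linear map commuting with `P₊, P₋, L`. -/
def Iso (M N : E2Mod) : Prop :=
  ∃ e : M.V ≃ₗ[ℂ] N.V,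
    (∀ v, e (M.Pp v) = N.Pp (e v)) ∧ (∀ v, e (M.Pm v) = N.Pm (e v)) ∧
      (∀ v, e (M.L v) = N.L (e v))

end E2Mod

/-- `V` is generated by the set `S` if the only submodule of `V` containing `S` is `V`. -/
def E2Mod.GenBy (M : E2Mod) (S : Set M.V) : Prop :=
  ∀ W : Submodule ℂ M.V, M.IsSubmod W → S ⊆ (W : Set M.V) → W = ⊤

/-- The nonzero vectors among the iterates of `v` under an endomorphism that kills `v` after
`n` steps are linearly independent. -/
theorem linearIndependent_pow_apply_of_minimal {K V : Type*} [Field K] [AddCommGroup V]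
    [Module K V] (T : Module.End K V) (v : V) {n : ℕ} (hn : (T ^ n) v = 0)
    (hmin : ∀ m < n, (T ^ m) v ≠ 0) :
    LinearIndependent K fun j : Fin n => (T ^ (j : ℕ)) v := by
  rw [Fintype.linearIndependent_iff]
  intro g hg
  have key : ∀ m (hm : m < n), g ⟨m, hm⟩ = 0 := by
    intro m
    induction m using Nat.strong_induction_on with
    | _ m ih =>
      intro hm
      have h := congrArg (T ^ (n - 1 - m)) hg
      rw [map_sum, map_zero, Finset.sum_eq_single ⟨m, hm⟩] at h
      · rw [map_smul, ← Module.End.mul_apply, ← pow_add, smul_eq_zero] at h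
        exact h.resolve_right (hmin _ (by dsimp only; omega))
      · rintro ⟨l, hl⟩ - hne
        have hne' : l ≠ m := fun h => hne (Fin.ext h)
        rcases lt_or_gt_of_ne hne' with h | h
        · rw [ih l h hl, zero_smul, map_zero]
        · rw [map_smul, ← Module.End.mul_apply, ← pow_add]
          have : n - 1 - m + l = (n - 1 - m + l - n) + n := by omega
          dsimp only
          rw [this, pow_add, Module.End.mul_apply, hn, map_zero, smul_zero]
      · simp
  exact fun i => key i i.2

/-- If independent submodules `A i` contain submodules `B i` that span everything, then
`B = A`. -/
theorem iSupIndep.eq_of_le_of_iSup_eq_top {K V ι : Type*} [Ring K] [AddCommGroup V]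
    [Module K V] {A B : ι → Submodule K V} (hA : iSupIndep A) (hle : ∀ i, B i ≤ A i)
    (htop : ⨆ i, B i = ⊤) (i : ι) : B i = A i := by
  refine le_antisymm (hle i) fun v hv => ?_
  have h1 : (⊤ : Submodule K V) ≤ B i ⊔ ⨆ j, ⨆ _ : j ≠ i, A j := by
    rw [← htop]
    refine iSup_le fun j => ?_
    by_cases h : j = i
    · subst h
      exact le_sup_left
    · exact (hle j).trans (le_trans (le_iSup₂_of_le j h le_rfl) le_sup_right)
  obtain ⟨b, hb, c, hc, rfl⟩ := Submodule.mem_sup.1 (h1 (Submodule.mem_top (x := v)))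
  have hcA : c ∈ A i := by simpa using (A i).sub_mem hv (hle i hb)
  have : c = 0 := (Submodule.disjoint_def.1 (hA i)) c hcA hc
  simpa [this] using hb

namespace E2Mod

theorem mem_wt {M : E2Mod} {k : ℤ} {v : M.V} : v ∈ M.wt k ↔ M.L v = (k : ℂ) • v := by
  simp [wt, sub_eq_zero]

theorem Pp_mem_wt {M : E2Mod} {k : ℤ} {v : M.V} (hv : v ∈ M.wt k) :
    M.Pp v ∈ M.wt (k + 1) := by
  rw [mem_wt] at hv ⊢
  have h := LinearMap.congr_fun M.relp v
  simp only [LinearMap.sub_apply, LinearMap.comp_apply, hv, map_smul] at h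
  rw [sub_eq_iff_eq_add] at h
  rw [h]
  push_cast
  module

theorem Pm_mem_wt {M : E2Mod} {k : ℤ} {v : M.V} (hv : v ∈ M.wt k) :
    M.Pm v ∈ M.wt (k - 1) := by
  rw [mem_wt] at hv ⊢
  have h := LinearMap.congr_fun M.relm v
  simp only [LinearMap.sub_apply, LinearMap.comp_apply, hv, map_smul, LinearMap.neg_apply] at h
  rw [sub_eq_iff_eq_add] at h
  rw [h]
  push_cast
  module

theorem commute_Pp_Pm (M : E2Mod) : Commute (M.Pp : Module.End ℂ M.V) M.Pm := M.comm

/-- The vector `P₊ⁱ P₋ʲ u`. -/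
def mon (M : E2Mod) (u : M.V) (i j : ℕ) : M.V :=
  ((M.Pp : Module.End ℂ M.V) ^ i) (((M.Pm : Module.End ℂ M.V) ^ j) u)

theorem Pp_mon (M : E2Mod) (u : M.V) (i j : ℕ) : M.Pp (M.mon u i j) = M.mon u (i + 1) j := by
  simp [mon, pow_succ']

theorem Pm_mon (M : E2Mod) (u : M.V) (i j : ℕ) : M.Pm (M.mon u i j) = M.mon u i (j + 1) := by
  have h := LinearMap.congr_fun ((M.commute_Pp_Pm.pow_left i).eq)
    (((M.Pm : Module.End ℂ M.V) ^ j) u)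
  simp only [Module.End.mul_apply] at h
  simp [mon, pow_succ', h]

theorem mon_mem_wt {M : E2Mod} {a : ℤ} {u : M.V} (hu : u ∈ M.wt a) (i j : ℕ) :
    M.mon u i j ∈ M.wt (a + i - j) := by
  induction i with
  | zero =>
    induction j with
    | zero => simpa [mon] using hu
    | succ j ih =>
      rw [← Pm_mon]
      convert Pm_mem_wt ih using 2
      push_cast
      ring
  | succ i ih =>
    rw [← Pp_mon]
    convert Pp_mem_wt ih using 2
    push_cast
    ring

/-- The vector `P₊ⁱ P₋ʲ u` of weight `k` with `min i j = n`, where `u` has weight `a`. -/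
def wvec (M : E2Mod) (a : ℤ) (u : M.V) (k : ℤ) (n : ℕ) : M.V :=
  M.mon u (n + (k - a).toNat) (n + (a - k).toNat)

theorem mon_eq_wvec (M : E2Mod) (a : ℤ) (u : M.V) (i j : ℕ) :
    M.mon u i j = M.wvec a u (a + i - j) (min i j) := by
  unfold wvec
  congr 1 <;> omega

theorem wvec_mem_wt {M : E2Mod} {a : ℤ} {u : M.V} (hu : u ∈ M.wt a) (k : ℤ) (n : ℕ) :
    M.wvec a u k n ∈ M.wt k := by
  have h := mon_mem_wt hu (n + (k - a).toNat) (n + (a - k).toNat)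
  rwa [show a + ((n + (k - a).toNat : ℕ) : ℤ) - ((n + (a - k).toNat : ℕ) : ℤ) = k by omega] at h

theorem wvec_eq_pow (M : E2Mod) (a : ℤ) (u : M.V) (k : ℤ) (n : ℕ) :
    M.wvec a u k n = ((M.Pp.comp M.Pm : Module.End ℂ M.V) ^ n) (M.wvec a u k 0) := by
  induction n with
  | zero => simp
  | succ n ih =>
    rw [pow_succ', Module.End.mul_apply, ← ih, LinearMap.comp_apply, wvec, wvec, Pm_mon, Pp_mon]
    congr 1 <;> omega

theorem exists_pow_Pp_eq_zero (M : E2Mod) {k : ℤ} {v : M.V} (hv : v ∈ M.wt k) :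
    ∃ n : ℕ, ((M.Pp : Module.End ℂ M.V) ^ n) v = 0 := by
  by_contra! h
  have hm : ∀ n : ℕ, Module.End.HasEigenvalue (M.L : Module.End ℂ M.V) (((k + n : ℤ)) : ℂ) := by
    intro n
    have hw := mem_wt.1 (mon_mem_wt hv n 0)
    refine Module.End.hasEigenvalue_of_hasEigenvector (x := M.mon v n 0)
      ⟨Module.End.mem_eigenspace_iff.2 (by simpa using hw), h n⟩
  have hinj : Function.Injective fun n : ℕ => (((k + n : ℤ)) : ℂ) := by
    intro m n hmn
    simpa using hmn
  exact (Set.infinite_range_of_injective hinj)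
    ((Module.End.finite_hasEigenvalue (M.L : Module.End ℂ M.V)).subset
      (Set.range_subset_iff.2 hm))

theorem exists_wvec_eq_zero {M : E2Mod} {a : ℤ} {u : M.V} (hu : u ∈ M.wt a) (k : ℤ) :
    ∃ n, M.wvec a u k n = 0 := by
  obtain ⟨n, hn⟩ := M.exists_pow_Pp_eq_zero (mon_mem_wt hu 0 (a - k).toNat)
  refine ⟨n, ?_⟩
  have h0 : M.mon u n (a - k).toNat = 0 := by simpa [mon] using hn
  have h1 : ∀ i, M.mon u (n + i) (a - k).toNat = 0 := by
    intro i
    induction i with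
    | zero => exact h0
    | succ i ih => rw [← add_assoc, ← Pp_mon, ih, map_zero]
  have h2 : ∀ j, M.mon u (n + (k - a).toNat) (j + (a - k).toNat) = 0 := by
    intro j
    induction j with
    | zero => simpa using h1 _
    | succ j ih => rw [add_right_comm, ← Pm_mon, ih, map_zero]
  exact h2 n

theorem iSup_span_wvec_eq_top {M : E2Mod} {a : ℤ} {u : M.V} (hu : u ∈ M.wt a)
    (hgen : M.GenBy {u}) : ⨆ k, Submodule.span ℂ (Set.range (M.wvec a u k)) = ⊤ := by
  rw [← Submodule.span_iUnion]
  have hmem : ∀ i j, M.mon u i j ∈ Submodule.span ℂ (⋃ k, Set.range (M.wvec a u k)) := fun i j =>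
    Submodule.subset_span (Set.mem_iUnion.2 ⟨_, _, (M.mon_eq_wvec a u i j).symm⟩)
  have hstable : ∀ f : M.V →ₗ[ℂ] M.V,
      (∀ k n, f (M.wvec a u k n) ∈ Submodule.span ℂ (⋃ k, Set.range (M.wvec a u k))) →
      ∀ v ∈ Submodule.span ℂ (⋃ k, Set.range (M.wvec a u k)),
        f v ∈ Submodule.span ℂ (⋃ k, Set.range (M.wvec a u k)) := by
    intro f hf v hv
    have hle : Submodule.span ℂ (⋃ k, Set.range (M.wvec a u k)) ≤
        (Submodule.span ℂ (⋃ k, Set.range (M.wvec a u k))).comap f := by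
      refine Submodule.span_le.2 fun x hx => ?_
      obtain ⟨k, n, rfl⟩ := Set.mem_iUnion.1 hx
      exact hf k n
    exact hle hv
  refine hgen _ ⟨hstable _ fun k n => ?_, hstable _ fun k n => ?_, hstable _ fun k n => ?_⟩ ?_
  · rw [wvec, Pp_mon]
    exact hmem _ _
  · rw [wvec, Pm_mon]
    exact hmem _ _
  · rw [mem_wt.1 (wvec_mem_wt hu k n)]
    exact Submodule.smul_mem _ _ (hmem _ _)
  · simpa [mon] using hmem 0 0

theorem iSupIndep_wt (M : E2Mod) : iSupIndep M.wt :=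
  DirectSum.IsInternal.submodule_iSupIndep M.internal

theorem span_wvec_eq_wt {M : E2Mod} {a : ℤ} {u : M.V} (hu : u ∈ M.wt a)
    (hgen : M.GenBy {u}) (k : ℤ) : Submodule.span ℂ (Set.range (M.wvec a u k)) = M.wt k := by
  refine M.iSupIndep_wt.eq_of_le_of_iSup_eq_top (fun i => Submodule.span_le.2 ?_)
    (iSup_span_wvec_eq_top hu hgen) k
  rintro _ ⟨n, rfl⟩
  exact wvec_mem_wt hu i n

theorem wvec_eq_zero_and_linearIndependent {M : E2Mod} {a : ℤ} {u : M.V} (hu : u ∈ M.wt a)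
    (hgen : M.GenBy {u}) (k : ℤ) :
    (∀ n, Module.finrank ℂ (M.wt k) ≤ n → M.wvec a u k n = 0) ∧
      LinearIndependent ℂ
        fun j : Fin (Module.finrank ℂ (M.wt k)) => M.wvec a u k j := by
  classical
  have hex := exists_wvec_eq_zero hu k
  have hlt : ∀ m < Nat.find hex, M.wvec a u k m ≠ 0 := fun m hm => Nat.find_min hex hm
  have hge : ∀ m, Nat.find hex ≤ m → M.wvec a u k m = 0 := by
    intro m hm
    rw [wvec_eq_pow, ← Nat.sub_add_cancel hm, pow_add, Module.End.mul_apply, ← wvec_eq_pow,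
      Nat.find_spec hex, map_zero]
  have hli : LinearIndependent ℂ fun j : Fin (Nat.find hex) => M.wvec a u k j := by
    have h := linearIndependent_pow_apply_of_minimal (M.Pp.comp M.Pm) (M.wvec a u k 0)
      (n := Nat.find hex) (by rw [← wvec_eq_pow]; exact hge _ le_rfl)
      fun m hm => by rw [← wvec_eq_pow]; exact hlt m hm
    simpa only [← wvec_eq_pow] using h
  have hspan : Submodule.span ℂ (Set.range fun j : Fin (Nat.find hex) => M.wvec a u k j) =
      M.wt k := by
    rw [← span_wvec_eq_wt hu hgen k]
    refine le_antisymm (Submodule.span_mono ?_) (Submodule.span_le.2 ?_)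
    · rintro _ ⟨j, rfl⟩
      exact ⟨j, rfl⟩
    · rintro _ ⟨n, rfl⟩
      rcases lt_or_ge n (Nat.find hex) with h | h
      · exact Submodule.subset_span ⟨⟨n, h⟩, rfl⟩
      · rw [hge n h]
        exact Submodule.zero_mem _
  have hfr : Module.finrank ℂ (M.wt k) = Nat.find hex := by
    rw [← hspan, finrank_span_eq_card hli, Fintype.card_fin]
  rw [hfr]
  exact ⟨hge, hli⟩

theorem exists_basis_wvec {M : E2Mod} {a : ℤ} {u : M.V} (hu : u ∈ M.wt a)
    (hgen : M.GenBy {u}) :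
    ∃ b : Module.Basis (Σ k : ℤ, Fin (Module.finrank ℂ (M.wt k))) ℂ M.V,
      ∀ i, b i = M.wvec a u i.1 i.2 := by
  have hli : ∀ k, LinearIndependent ℂ fun j : Fin (Module.finrank ℂ (M.wt k)) =>
      (⟨M.wvec a u k j, wvec_mem_wt hu k j⟩ : M.wt k) := fun k =>
    LinearIndependent.of_comp (M.wt k).subtype (wvec_eq_zero_and_linearIndependent hu hgen k).2
  have hint : DirectSum.IsInternal M.wt := M.internal
  refine ⟨hint.collectedBasis fun k =>
    basisOfLinearIndependentOfCardEqFinrank' _ (hli k) (Fintype.card_fin _), fun i => ?_⟩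
  simp [DirectSum.IsInternal.collectedBasis_coe]

theorem Pp_wvec (M : E2Mod) (a : ℤ) (u : M.V) (k : ℤ) (n : ℕ) :
    M.Pp (M.wvec a u k n) = M.wvec a u (k + 1) (if a ≤ k then n else n + 1) := by
  rw [wvec, wvec, Pp_mon]
  split_ifs <;> congr 1 <;> omega

theorem Pm_wvec (M : E2Mod) (a : ℤ) (u : M.V) (k : ℤ) (n : ℕ) :
    M.Pm (M.wvec a u k n) = M.wvec a u (k - 1) (if k ≤ a then n else n + 1) := by
  rw [wvec, wvec, Pm_mon]
  split_ifs <;> congr 1 <;> omega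

end E2Mod

/-- Two `e(2)`-modules, each generated by a single weight vector of weight `a`, having
the same weight-space dimensions, are isomorphic. -/
theorem stmt_8 (a : ℤ) (M M' : E2Mod)
    (u : M.V) (hu : u ∈ M.wt a) (hu0 : u ≠ 0) (hgen : M.GenBy {u})
    (u' : M'.V) (hu' : u' ∈ M'.wt a) (hu0' : u' ≠ 0) (hgen' : M'.GenBy {u'})
    (hdim : ∀ k : ℤ, Module.finrank ℂ (M.wt k) = Module.finrank ℂ (M'.wt k)) :
    M.Iso M' := by
  obtain ⟨b, hb⟩ := E2Mod.exists_basis_wvec hu hgen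
  obtain ⟨b', hb'⟩ := E2Mod.exists_basis_wvec hu' hgen'
  let e : M.V ≃ₗ[ℂ] M'.V :=
    b.equiv b' (Equiv.sigmaCongrRight fun k => finCongr (hdim k))
  have he : ∀ k n, e (M.wvec a u k n) = M'.wvec a u' k n := by
    intro k n
    rcases lt_or_ge n (Module.finrank ℂ (M.wt k)) with h | h
    · have h1 := b.equiv_apply ⟨k, ⟨n, h⟩⟩ b'
        (Equiv.sigmaCongrRight fun k => finCongr (hdim k))
      rw [hb, hb'] at h1
      exact h1
    · rw [(E2Mod.wvec_eq_zero_and_linearIndependent hu hgen k).1 n h,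
        (E2Mod.wvec_eq_zero_and_linearIndependent hu' hgen' k).1 n (hdim k ▸ h), map_zero]
  have hcomm : ∀ (f : M.V →ₗ[ℂ] M.V) (g : M'.V →ₗ[ℂ] M'.V),
      (∀ k n, e (f (M.wvec a u k n)) = g (M'.wvec a u' k n)) → ∀ v, e (f v) = g (e v) := by
    intro f g hfg
    refine LinearMap.congr_fun (f := e.toLinearMap ∘ₗ f) (g := g ∘ₗ e.toLinearMap)
      (b.ext fun i => ?_)
    simp [hb, he, hfg]
  refine ⟨e, hcomm _ _ fun k n => ?_, hcomm _ _ fun k n => ?_, hcomm _ _ fun k n => ?_⟩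
  · rw [E2Mod.Pp_wvec, E2Mod.Pp_wvec, he]
  · rw [E2Mod.Pm_wvec, E2Mod.Pm_wvec, he]
  · rw [E2Mod.mem_wt.1 (E2Mod.wvec_mem_wt hu k n), E2Mod.mem_wt.1 (E2Mod.wvec_mem_wt hu' k n),
      map_smul, he]
end

section
/- For every a ∈ ℤ there exist infinitely many pairwise non-isomorphic indecomposable e(2)-modules V with V_k = 0 for all k ∉ {a, a+1, a+2, a+3, a+4}; that is, there is a sequence (Vⁿ)_{n∈ℕ} of indecomposable e(2)-modules, all of whose weights lie in {a, …, a+4}, with Vⁿ ≇ Vᵐ for n ≠ m. -/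
/-- A diagonal endomorphism with integer entries is diagonalizable with integer eigenvalues. -/
theorem isInternal_ker_sub_of_diagonal {ι : Type} [Fintype ι] [DecidableEq ι] (d : ι → ℤ)
    (L : (ι → ℂ) →ₗ[ℂ] (ι → ℂ)) (hL : ∀ v i, L v i = d i * v i) :
    DirectSum.IsInternal fun k : ℤ =>
      LinearMap.ker (L - (k : ℂ) • (LinearMap.id : (ι → ℂ) →ₗ[ℂ] (ι → ℂ))) := by
  have hker : (fun k : ℤ => LinearMap.ker (L - (k : ℂ) • (LinearMap.id : (ι → ℂ) →ₗ[ℂ] (ι → ℂ))))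
      = fun k : ℤ => Module.End.eigenspace L (k : ℂ) := by
    funext k
    ext v
    simp [sub_eq_zero]
  rw [hker, DirectSum.isInternal_submodule_iff_iSupIndep_and_iSup_eq_top]
  refine ⟨(Module.End.eigenspaces_iSupIndep L).comp Int.cast_injective, ?_⟩
  rw [eq_top_iff]
  intro v _
  rw [← Finset.univ_sum_single v]
  refine Submodule.sum_mem _ fun i _ => Submodule.mem_iSup_of_mem (d i) ?_
  rw [Module.End.mem_eigenspace_iff]
  ext j
  rw [hL]
  by_cases h : j = i
  · subst h
    simp
  · simp [h]

/-- A nonzero module whose only idempotent endomorphisms are `0` and `1` is indecomposable. -/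
theorem E2Mod.indecomposable_of_idempotents (M : E2Mod) (h0 : ∃ v : M.V, v ≠ 0)
    (h : ∀ φ : M.V →ₗ[ℂ] M.V, (∀ v, φ (M.Pp v) = M.Pp (φ v)) → (∀ v, φ (M.Pm v) = M.Pm (φ v)) →
      (∀ v, φ (M.L v) = M.L (φ v)) → (∀ v, φ (φ v) = φ v) → (∀ v, φ v = 0) ∨ ∀ v, φ v = v) :
    M.Indecomposable := by
  refine ⟨h0, fun W₁ W₂ hW₁ hW₂ hinf hsup => ?_⟩
  have hc : IsCompl W₁ W₂ := ⟨disjoint_iff.2 hinf, codisjoint_iff.2 hsup⟩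
  have hfix : ∀ w ∈ W₁, W₁.projection W₂ hc w = w := fun w hw => by
    simpa using Submodule.projection_apply_left hc ⟨w, hw⟩
  have hzero : ∀ w ∈ W₂, W₁.projection W₂ hc w = 0 := fun w hw =>
    (Submodule.projection_apply_eq_zero_iff hc).2 hw
  have hcomm : ∀ T : M.V →ₗ[ℂ] M.V, (∀ v ∈ W₁, T v ∈ W₁) → (∀ v ∈ W₂, T v ∈ W₂) →
      ∀ v, W₁.projection W₂ hc (T v) = T ((W₁.projection W₂ hc) v) := by
    intro T h₁ h₂ v
    obtain ⟨w₁, hw₁, w₂, hw₂, rfl⟩ := Submodule.mem_sup.1 (hsup ▸ Submodule.mem_top : v ∈ W₁ ⊔ W₂)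
    simp only [map_add]
    rw [hfix _ (h₁ _ hw₁), hzero _ (h₂ _ hw₂), hfix _ hw₁, hzero _ hw₂, map_zero]
  rcases h (W₁.projection W₂ hc) (hcomm _ hW₁.1 hW₂.1) (hcomm _ hW₁.2.1 hW₂.2.1)
    (hcomm _ hW₁.2.2 hW₂.2.2)
    (fun v => hfix _ (Submodule.projection_apply_mem hc v)) with h | h
  · exact Or.inl ((Submodule.eq_bot_iff _).2 fun w hw => (hfix w hw).symm.trans (h w))
  · exact Or.inr ((Submodule.eq_bot_iff _).2 fun w hw => (h w).symm.trans (hzero w hw))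

namespace TubularFamily

/-- The weights, relative to the lowest one, of the standard basis vectors of `ℂ⁸`. -/
def weight : Fin 8 → ℤ := ![0, 1, 1, 2, 2, 3, 3, 4]

/-- The raising operator of the family member with parameter `l`. -/
def raise (l : ℂ) : (Fin 8 → ℂ) →ₗ[ℂ] (Fin 8 → ℂ) where
  toFun v := ![0, 0, v 0, v 1, 0, 0, v 3 + l * v 4, v 5]
  map_add' v w := by
    ext i
    fin_cases i <;> simp
    ring
  map_smul' c v := by
    ext i
    fin_cases i <;> simp
    ring

/-- The lowering operator of the family member with parameter `l`. -/
def lower (l : ℂ) : (Fin 8 → ℂ) →ₗ[ℂ] (Fin 8 → ℂ) where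
  toFun v := ![v 1, 0, v 3 + v 4, 0, v 5, 0, l * v 7, 0]
  map_add' v w := by
    ext i
    fin_cases i <;> simp <;> ring
  map_smul' c v := by
    ext i
    fin_cases i <;> simp <;> ring

/-- The weight operator with lowest weight `a`. -/
def grade (a : ℤ) : (Fin 8 → ℂ) →ₗ[ℂ] (Fin 8 → ℂ) where
  toFun v i := (a + weight i : ℤ) * v i
  map_add' v w := by
    ext i
    simp only [Pi.add_apply]
    ring
  map_smul' c v := by
    ext i
    simp only [Pi.smul_apply, smul_eq_mul, RingHom.id_apply]
    ring

theorem raise_apply (l : ℂ) (v : Fin 8 → ℂ) :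
    raise l v = ![0, 0, v 0, v 1, 0, 0, v 3 + l * v 4, v 5] := rfl

theorem lower_apply (l : ℂ) (v : Fin 8 → ℂ) :
    lower l v = ![v 1, 0, v 3 + v 4, 0, v 5, 0, l * v 7, 0] := rfl

theorem grade_apply (a : ℤ) (v : Fin 8 → ℂ) (i : Fin 8) :
    grade a v i = (a + weight i : ℤ) * v i := rfl

/-- The one-parameter family of modules of dimension vector `(1, 2, 2, 2, 1)`. -/
def family (a : ℤ) (l : ℂ) : E2Mod where
  V := Fin 8 → ℂ
  Pp := raise l
  Pm := lower l
  L := grade a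
  comm := by
    refine LinearMap.ext fun v => ?_
    ext i
    fin_cases i <;> simp [raise_apply, lower_apply]
  relp := by
    refine LinearMap.ext fun v => ?_
    ext i
    fin_cases i <;> simp [raise_apply, grade_apply, weight] <;> ring
  relm := by
    refine LinearMap.ext fun v => ?_
    ext i
    fin_cases i <;> simp [lower_apply, grade_apply, weight] <;> ring
  internal := isInternal_ker_sub_of_diagonal (fun i => a + weight i) _ (grade_apply a)

theorem apply_eq_zero_of_weight_ne {a : ℤ} {φ : (Fin 8 → ℂ) →ₗ[ℂ] (Fin 8 → ℂ)}
    (hL : ∀ v, φ (grade a v) = grade a (φ v)) {i j : Fin 8} (hij : weight j ≠ weight i) :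
    φ (Pi.single i 1) j = 0 := by
  have h : grade a (Pi.single i 1) = ((a + weight i : ℤ) : ℂ) • Pi.single i 1 := by
    ext k
    by_cases hk : k = i
    · subst hk
      simp [grade_apply]
    · simp [grade_apply, hk]
  have h' := congrFun (hL (Pi.single i 1)) j
  rw [h, map_smul, grade_apply, Pi.smul_apply, smul_eq_mul] at h'
  have h'' : ((weight i - weight j : ℤ) : ℂ) * φ (Pi.single i 1) j = 0 := by
    push_cast at h' ⊢
    linear_combination h'
  refine (mul_eq_zero.1 h'').resolve_left ?_
  exact_mod_cast sub_ne_zero.2 hij.symm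

/-- A homomorphism between members of the family is a scalar plus a nilpotent map, and the scalar
vanishes if the parameters differ. -/
theorem exists_scalar_of_intertwines {a : ℤ} {l m : ℂ} {φ : (Fin 8 → ℂ) →ₗ[ℂ] (Fin 8 → ℂ)}
    (hp : ∀ v, φ (raise l v) = raise m (φ v)) (hm : ∀ v, φ (lower l v) = lower m (φ v))
    (hL : ∀ v, φ (grade a v) = grade a (φ v)) :
    ∃ p q t : ℂ, l * p = m * p ∧
      ∀ v, φ v = p • v + ![0, 0, q * v 1, 0, 0, 0, t * v 5, 0] := by
  obtain ⟨p, q, hx⟩ : ∃ p q, φ (Pi.single 1 1) = ![0, p, q, 0, 0, 0, 0, 0] := by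
    refine ⟨φ (Pi.single 1 1) 1, φ (Pi.single 1 1) 2, ?_⟩
    ext i
    fin_cases i <;> first | rfl | exact apply_eq_zero_of_weight_ne hL (by decide)
  obtain ⟨s, t, hy⟩ : ∃ s t, φ (Pi.single 5 1) = ![0, 0, 0, 0, 0, s, t, 0] := by
    refine ⟨φ (Pi.single 5 1) 5, φ (Pi.single 5 1) 6, ?_⟩
    ext i
    fin_cases i <;> first | rfl | exact apply_eq_zero_of_weight_ne hL (by decide)
  have e0 : (Pi.single 0 1 : Fin 8 → ℂ) = lower l (Pi.single 1 1) := by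
    ext i; fin_cases i <;> simp [lower_apply]
  have e3 : (Pi.single 3 1 : Fin 8 → ℂ) = raise l (Pi.single 1 1) := by
    ext i; fin_cases i <;> simp [raise_apply]
  have e4 : (Pi.single 4 1 : Fin 8 → ℂ) = lower l (Pi.single 5 1) := by
    ext i; fin_cases i <;> simp [lower_apply]
  have e7 : (Pi.single 7 1 : Fin 8 → ℂ) = raise l (Pi.single 5 1) := by
    ext i; fin_cases i <;> simp [raise_apply]
  have e2 : (Pi.single 2 1 : Fin 8 → ℂ) = lower l (Pi.single 3 1) := by
    ext i; fin_cases i <;> simp [lower_apply]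
  have e2' : (Pi.single 2 1 : Fin 8 → ℂ) = lower l (Pi.single 4 1) := by
    ext i; fin_cases i <;> simp [lower_apply]
  have e6 : (Pi.single 6 1 : Fin 8 → ℂ) = raise l (Pi.single 3 1) := by
    ext i; fin_cases i <;> simp [raise_apply]
  have e6' : l • (Pi.single 6 1 : Fin 8 → ℂ) = raise l (Pi.single 4 1) := by
    ext i; fin_cases i <;> simp [raise_apply]
  have f0 : φ (Pi.single 0 1) = ![p, 0, 0, 0, 0, 0, 0, 0] := by
    rw [e0, hm, hx]; ext i; fin_cases i <;> simp [lower_apply]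
  have f3 : φ (Pi.single 3 1) = ![0, 0, 0, p, 0, 0, 0, 0] := by
    rw [e3, hp, hx]; ext i; fin_cases i <;> simp [raise_apply]
  have f4 : φ (Pi.single 4 1) = ![0, 0, 0, 0, s, 0, 0, 0] := by
    rw [e4, hm, hy]; ext i; fin_cases i <;> simp [lower_apply]
  have f7 : φ (Pi.single 7 1) = ![0, 0, 0, 0, 0, 0, 0, s] := by
    rw [e7, hp, hy]; ext i; fin_cases i <;> simp [raise_apply]
  have f2 : φ (Pi.single 2 1) = ![0, 0, p, 0, 0, 0, 0, 0] := by
    rw [e2, hm, f3]; ext i; fin_cases i <;> simp [lower_apply]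
  have f6 : φ (Pi.single 6 1) = ![0, 0, 0, 0, 0, 0, p, 0] := by
    rw [e6, hp, f3]; ext i; fin_cases i <;> simp [raise_apply]
  obtain rfl : p = s := by
    have h := f2
    rw [e2', hm, f4] at h
    simpa [lower_apply] using (congrFun h 2).symm
  have hlm : l * p = m * p := by
    have h : φ (l • Pi.single 6 1) = raise m (φ (Pi.single 4 1)) := by rw [e6', hp]
    rw [map_smul, f4, f6] at h
    simpa [raise_apply] using congrFun h 6
  refine ⟨p, q, t, hlm, fun v => ?_⟩
  have hv : v = ∑ i, v i • Pi.single i (1 : ℂ) := by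
    rw [← pi_eq_sum_univ' v]
  conv_lhs => rw [hv]
  rw [Fin.sum_univ_eight]
  simp only [map_add, map_smul]
  rw [f0, hx, f2, f3, f4, hy, f6, f7]
  ext i
  fin_cases i <;> simp <;> ring

theorem eq_zero_or_id_of_idempotent {a : ℤ} {l : ℂ} {φ : (Fin 8 → ℂ) →ₗ[ℂ] (Fin 8 → ℂ)}
    (hp : ∀ v, φ (raise l v) = raise l (φ v)) (hm : ∀ v, φ (lower l v) = lower l (φ v))
    (hL : ∀ v, φ (grade a v) = grade a (φ v)) (hφ : ∀ v, φ (φ v) = φ v) :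
    (∀ v, φ v = 0) ∨ ∀ v, φ v = v := by
  obtain ⟨p, q, t, -, h⟩ := exists_scalar_of_intertwines hp hm hL
  have c0 (v) : φ v 0 = p * v 0 := by simp [h]
  have c1 (v) : φ v 1 = p * v 1 := by simp [h]
  have c2 (v) : φ v 2 = p * v 2 + q * v 1 := by simp [h]
  have c5 (v) : φ v 5 = p * v 5 := by simp [h]
  have c6 (v) : φ v 6 = p * v 6 + t * v 5 := by simp [h]
  have h0 : p * p = p := by simpa [c0] using congrFun (hφ (Pi.single 0 1)) 0
  have h1 : p * q + q * p = q := by simpa [c1, c2] using congrFun (hφ (Pi.single 1 1)) 2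
  have h5 : p * t + t * p = t := by simpa [c5, c6] using congrFun (hφ (Pi.single 5 1)) 6
  have hq : q = 0 := by linear_combination (2 * p - 1) * h1 - 4 * q * h0
  have ht : t = 0 := by linear_combination (2 * p - 1) * h5 - 4 * t * h0
  have hs : ∀ v, φ v = p • v := fun v => by
    rw [h, hq, ht]
    ext i
    fin_cases i <;> simp
  rcases mul_eq_zero.1 (show p * (p - 1) = 0 by linear_combination h0) with hp0 | hp1
  · exact Or.inl fun v => by rw [hs, hp0, zero_smul]
  · exact Or.inr fun v => by rw [hs, sub_eq_zero.1 hp1, one_smul]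

theorem family_indecomposable (a : ℤ) (l : ℂ) : (family a l).Indecomposable :=
  E2Mod.indecomposable_of_idempotents _
    ⟨(Pi.single 0 1 : Fin 8 → ℂ),
      (Pi.single_ne_zero_iff (i := (0 : Fin 8))).2 (one_ne_zero (α := ℂ))⟩
    fun _ hp hm hL hφ => eq_zero_or_id_of_idempotent hp hm hL hφ

theorem family_wt_eq_bot (a : ℤ) (l : ℂ) {k : ℤ} (hk : k ∉ Set.Icc a (a + 4)) :
    (family a l).wt k = ⊥ := by
  refine (Submodule.eq_bot_iff _).2 fun (v : Fin 8 → ℂ) hv => ?_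
  have hv' : grade a v - (k : ℂ) • v = 0 := hv
  refine funext fun i => ?_
  have hi := congrFun hv' i
  rw [Pi.sub_apply, grade_apply, Pi.smul_apply, smul_eq_mul, ← sub_mul, ← Int.cast_sub] at hi
  refine (mul_eq_zero.1 hi).resolve_left ?_
  have hw : ∀ i, 0 ≤ weight i ∧ weight i ≤ 4 := by decide
  rw [Set.mem_Icc] at hk
  have := hw i
  exact Int.cast_ne_zero.2 (by omega)

theorem eq_of_family_iso {a : ℤ} {l m : ℂ} (h : (family a l).Iso (family a m)) : l = m := by
  obtain ⟨e, hp, hm, hL⟩ := h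
  let φ : (Fin 8 → ℂ) →ₗ[ℂ] (Fin 8 → ℂ) := e.toLinearMap
  obtain ⟨p, q, t, hlm, h⟩ := exists_scalar_of_intertwines (φ := φ) hp hm hL
  refine mul_right_cancel₀ (fun hp0 => ?_) hlm
  have h0 : φ (Pi.single 0 1) = 0 := by
    rw [h, hp0]
    ext i
    fin_cases i <;> simp
  have h1 : (Pi.single 0 1 : Fin 8 → ℂ) = 0 := e.injective (h0.trans (map_zero φ).symm)
  simpa using congrFun h1 0

end TubularFamily

/-- For every `a ∈ ℤ` there are infinitely many pairwise non-isomorphic indecomposable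
`e(2)`-modules all of whose weights lie in `{a, a+1, a+2, a+3, a+4}`. -/
theorem stmt_15 (a : ℤ) :
    ∃ Vs : ℕ → E2Mod,
      (∀ n : ℕ, (Vs n).Indecomposable) ∧
      (∀ n : ℕ, ∀ k : ℤ, k ∉ Set.Icc a (a + 4) → (Vs n).wt k = ⊥) ∧
      (∀ n m : ℕ, n ≠ m → ¬ (Vs n).Iso (Vs m)) :=
  ⟨fun n => TubularFamily.family a n, fun n => TubularFamily.family_indecomposable a n,
    fun n _ hk => TubularFamily.family_wt_eq_bot a n hk,
    fun _ _ hnm h => hnm (Nat.cast_injective (TubularFamily.eq_of_family_iso h))⟩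
end

section
/- For all integers a ≤ b, the preprojective algebra P(Q_{a,b}) of type A_{b−a+1} is finite-dimensional over ℂ. Concretely: the quotient of the free associative unital ℂ-algebra on generators {ε_i : a ≤ i ≤ b} ∪ {h_i, h̄_i : a ≤ i ≤ b−1} by the two-sided ideal generated by the elements ε_i ε_j − δ_{ij} ε_i (a ≤ i, j ≤ b), 1 − (ε_a + ε_{a+1} + ⋯ + ε_b), h_i − ε_{i+1} h_i ε_i and h̄_i − ε_i h̄_i ε_{i+1} (a ≤ i ≤ b−1), together with the Gelfand–Ponomarev relations r_i for a ≤ i ≤ b, where r_a = h̄_a h_a, r_b = h_{b−1} h̄_{b−1}, and r_i = h̄_i h_i − h_{i−1} h̄_{i−1} for a < i < b, is a finite-dimensional ℂ-algebra. -/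
/-- Generators of the preprojective algebra `P(Q_{a,b})` of type `A_{b-a+1}`:
trivial paths `eps i` (`a ≤ i ≤ b`), arrows `arr i : i → i+1` and reversed arrows
`rev i : i+1 → i` (`a ≤ i ≤ b-1`). -/
inductive PPGen (a b : ℤ) : Type
  | eps (i : ℤ) (h1 : a ≤ i) (h2 : i ≤ b)
  | arr (i : ℤ) (h1 : a ≤ i) (h2 : i ≤ b - 1)
  | rev (i : ℤ) (h1 : a ≤ i) (h2 : i ≤ b - 1)

/-- The free associative unital `ℂ`-algebra on the generators. -/
abbrev PPFree (a b : ℤ) : Type := FreeAlgebra ℂ (PPGen a b)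

namespace PPFree

def e (a b i : ℤ) (h1 : a ≤ i) (h2 : i ≤ b) : PPFree a b :=
  FreeAlgebra.ι ℂ (PPGen.eps i h1 h2)

def f (a b i : ℤ) (h1 : a ≤ i) (h2 : i ≤ b - 1) : PPFree a b :=
  FreeAlgebra.ι ℂ (PPGen.arr i h1 h2)

def g (a b i : ℤ) (h1 : a ≤ i) (h2 : i ≤ b - 1) : PPFree a b :=
  FreeAlgebra.ι ℂ (PPGen.rev i h1 h2)

end PPFree

open PPFree in
/-- The defining relations of the preprojective algebra `P(Q_{a,b})`:
`εᵢεⱼ = δᵢⱼεᵢ`; `1 = ε_a + ⋯ + ε_b`; `hᵢ = ε_{i+1} hᵢ εᵢ`; `h̄ᵢ = εᵢ h̄ᵢ ε_{i+1}`;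
and the Gelfand–Ponomarev relations `r_a = h̄_a h_a`, `r_b = h_{b-1} h̄_{b-1}`,
`r_i = h̄ᵢhᵢ − h_{i-1}h̄_{i-1}` for `a < i < b`. -/
inductive PPRel (a b : ℤ) : PPFree a b → PPFree a b → Prop
  | eps_mul (i j : ℤ) (hi1 : a ≤ i) (hi2 : i ≤ b) (hj1 : a ≤ j) (hj2 : j ≤ b) :
      PPRel a b (e a b i hi1 hi2 * e a b j hj1 hj2)
        (if i = j then e a b i hi1 hi2 else 0)
  | one_eq :
      PPRel a b 1
        (∑ i ∈ (Finset.Icc a b).attach,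
          e a b i.1 (Finset.mem_Icc.mp i.2).1 (Finset.mem_Icc.mp i.2).2)
  | arr_sandwich (i : ℤ) (h1 : a ≤ i) (h2 : i ≤ b - 1) :
      PPRel a b (f a b i h1 h2)
        (e a b (i + 1) (by omega) (by omega) * f a b i h1 h2 * e a b i h1 (by omega))
  | rev_sandwich (i : ℤ) (h1 : a ≤ i) (h2 : i ≤ b - 1) :
      PPRel a b (g a b i h1 h2)
        (e a b i h1 (by omega) * g a b i h1 h2 * e a b (i + 1) (by omega) (by omega))
  | gp_left (h : a < b) :
      PPRel a b (g a b a le_rfl (by omega) * f a b a le_rfl (by omega)) 0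
  | gp_right (h : a < b) :
      PPRel a b (f a b (b - 1) (by omega) (by omega) * g a b (b - 1) (by omega) (by omega)) 0
  | gp_mid (i : ℤ) (h1 : a < i) (h2 : i < b) :
      PPRel a b (g a b i (by omega) (by omega) * f a b i (by omega) (by omega))
        (f a b (i - 1) (by omega) (by omega) * g a b (i - 1) (by omega) (by omega))

/-- Two commuting elements `X`, `Y` which shift a complete family of orthogonal idempotents
indexed by a bounded interval of `ℤ` up and down generate, together with that family,
a finite-dimensional algebra. -/
theorem finiteDimensional_of_adjoin_shift {K A : Type*} [Field K] [Ring A] [Algebra K A]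
    (a b : ℤ) (E : ℤ → A) (X Y : A)
    (hout : ∀ i, i ∉ Finset.Icc a b → E i = 0)
    (hone : ∑ i ∈ Finset.Icc a b, E i = 1)
    (hmul : ∀ i j, E i * E j = if i = j then E i else 0)
    (hX : ∀ i, X * E i = E (i + 1) * X)
    (hY : ∀ i, Y * E (i + 1) = E i * Y)
    (hXY : X * Y = Y * X)
    (htop : Algebra.adjoin K (Set.range E ∪ {X, Y}) = ⊤) :
    FiniteDimensional K A := by
  have hXp : ∀ (p : ℕ) i, X ^ p * E i = E (i + p) * X ^ p := by
    intro p
    induction p with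
    | zero => simp
    | succ p ih =>
      intro i
      rw [pow_succ, mul_assoc, hX, ← mul_assoc, ih, mul_assoc]
      congr 2
      push_cast
      ring
  have hYp : ∀ (p : ℕ) i, Y ^ p * E i = E (i - p) * Y ^ p := by
    intro p
    induction p with
    | zero => simp
    | succ p ih =>
      intro i
      have := hY (i - 1)
      rw [sub_add_cancel] at this
      rw [pow_succ, mul_assoc, this, ← mul_assoc, ih, mul_assoc]
      congr 2
      push_cast
      ring
  set n : ℕ := (b - a + 1).toNat with hn
  have hXn : X ^ n = 0 := by
    rw [← mul_one (X ^ n), ← hone, Finset.mul_sum]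
    refine Finset.sum_eq_zero fun i hi => ?_
    rw [Finset.mem_Icc] at hi
    rw [hXp, hout _ (by rw [Finset.mem_Icc]; omega), zero_mul]
  have hYn : Y ^ n = 0 := by
    rw [← mul_one (Y ^ n), ← hone, Finset.mul_sum]
    refine Finset.sum_eq_zero fun i hi => ?_
    rw [Finset.mem_Icc] at hi
    rw [hYp, hout _ (by rw [Finset.mem_Icc]; omega), zero_mul]
  let m : ℕ × ℕ × ℤ → A := fun t => X ^ t.1 * (Y ^ t.2.1 * E t.2.2)
  let s : Finset (ℕ × ℕ × ℤ) := Finset.range n ×ˢ Finset.range n ×ˢ Finset.Icc a b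
  let S : Submodule K A := Submodule.span K (m '' s)
  have hmem : ∀ (p q : ℕ) (i : ℤ), X ^ p * (Y ^ q * E i) ∈ S := by
    intro p q i
    by_cases hp : p < n
    · by_cases hq : q < n
      · by_cases hi : i ∈ Finset.Icc a b
        · refine Submodule.subset_span ⟨(p, q, i), ?_, rfl⟩
          simp only [s, Finset.coe_product, Set.mem_prod, Finset.mem_coe, Finset.mem_range]
          exact ⟨hp, hq, hi⟩
        · simp [hout i hi]
      · simp [pow_eq_zero_of_le (not_lt.mp hq) hYn]
    · simp [pow_eq_zero_of_le (not_lt.mp hp) hXn]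
  have hone_mem : (1 : A) ∈ S := by
    rw [← hone]
    exact Submodule.sum_mem _ fun i _ => by simpa using hmem 0 0 i
  have hgen : ∀ x ∈ Set.range E ∪ {X, Y}, ∀ p q i, x * (X ^ p * (Y ^ q * E i)) ∈ S := by
    rintro x (⟨j, rfl⟩ | rfl | rfl) p q i
    · have h : E j * (X ^ p * (Y ^ q * E i)) =
          (E j * E (i - q + p)) * (X ^ p * Y ^ q) := by
        rw [hYp, ← mul_assoc (X ^ p), hXp]
        simp only [mul_assoc]
      rw [h, hmul]
      split_ifs with hj
      · rw [hj, ← mul_assoc, ← hXp, mul_assoc, ← hYp]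
        exact hmem p q i
      · simp
    · rw [← mul_assoc, ← pow_succ']
      exact hmem _ _ _
    · have hc : x * X ^ p = X ^ p * x := ((show Commute X x from hXY).pow_left p).eq.symm
      rw [← mul_assoc, hc, mul_assoc, ← mul_assoc x, ← pow_succ']
      exact hmem _ _ _
  have hstable : ∀ x : A, ∀ y ∈ S, x * y ∈ S := by
    intro x
    have hx : x ∈ Algebra.adjoin K (Set.range E ∪ {X, Y}) := htop ▸ Algebra.mem_top
    induction hx using Algebra.adjoin_induction with
    | mem x hx =>
      intro y hy
      induction hy using Submodule.span_induction with
      | mem y hy =>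
        obtain ⟨t, -, rfl⟩ := hy
        exact hgen x hx _ _ _
      | zero => simp
      | add y z _ _ hy hz => rw [mul_add]; exact S.add_mem hy hz
      | smul c y _ hy => rw [mul_smul_comm]; exact S.smul_mem c hy
    | algebraMap r =>
      intro y hy
      rw [← Algebra.smul_def]
      exact S.smul_mem r hy
    | add x z _ _ hx hz =>
      intro y hy
      rw [add_mul]
      exact S.add_mem (hx y hy) (hz y hy)
    | mul x z _ _ hx hz =>
      intro y hy
      rw [mul_assoc]
      exact hx _ (hz y hy)
  have hS : S = ⊤ := by
    rw [eq_top_iff]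
    intro x _
    simpa using hstable x 1 hone_mem
  exact Module.finite_def.mpr (hS ▸ Submodule.fg_span (s.finite_toSet.image m))

/-- The type `A` preprojective relations, for families extended by zero to all of `ℤ`,
force finite-dimensionality. -/
theorem finiteDimensional_of_preprojective_relations {K A : Type*} [Field K] [Ring A]
    [Algebra K A] (a b : ℤ) (E H G : ℤ → A)
    (hE : ∀ i, i ∉ Finset.Icc a b → E i = 0)
    (hH : ∀ i, i ∉ Finset.Icc a (b - 1) → H i = 0)
    (hG : ∀ i, i ∉ Finset.Icc a (b - 1) → G i = 0)
    (hone : ∑ i ∈ Finset.Icc a b, E i = 1)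
    (hmul : ∀ i j, E i * E j = if i = j then E i else 0)
    (hHs : ∀ i, H i = E (i + 1) * H i * E i)
    (hGs : ∀ i, G i = E i * G i * E (i + 1))
    (hGP : ∀ i, G i * H i = H (i - 1) * G (i - 1))
    (htop : Algebra.adjoin K (Set.range E ∪ Set.range H ∪ Set.range G) = ⊤) :
    FiniteDimensional K A := by
  have hHE : ∀ i j, H i * E j = if i = j then H i else 0 := by
    intro i j
    rw [hHs i, mul_assoc, hmul]
    split_ifs <;> simp
  have hEH : ∀ i j, E j * H i = if j = i + 1 then H i else 0 := by
    intro i j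
    rw [hHs i, ← mul_assoc, ← mul_assoc, hmul]
    split_ifs with h <;> simp [h]
  have hGE : ∀ i j, G i * E j = if i + 1 = j then G i else 0 := by
    intro i j
    rw [hGs i, mul_assoc, hmul]
    split_ifs <;> simp
  have hEG : ∀ i j, E j * G i = if j = i then G i else 0 := by
    intro i j
    rw [hGs i, ← mul_assoc, ← mul_assoc, hmul]
    split_ifs with h <;> simp [h]
  set X : A := ∑ i ∈ Finset.Icc a (b - 1), H i with hXdef
  set Y : A := ∑ i ∈ Finset.Icc a (b - 1), G i with hYdef
  have hXE : ∀ i, X * E i = H i := by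
    intro i
    simp only [hXdef, Finset.sum_mul, hHE, Finset.sum_ite_eq']
    split_ifs with h
    · rfl
    · exact (hH i h).symm
  have hEX : ∀ i, E (i + 1) * X = H i := by
    intro i
    simp only [hXdef, Finset.mul_sum, hEH, add_left_inj, Finset.sum_ite_eq]
    split_ifs with h
    · rfl
    · exact (hH i h).symm
  have hYE : ∀ i, Y * E (i + 1) = G i := by
    intro i
    simp only [hYdef, Finset.sum_mul, hGE, add_left_inj, Finset.sum_ite_eq']
    split_ifs with h
    · rfl
    · exact (hG i h).symm
  have hEY : ∀ i, E i * Y = G i := by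
    intro i
    simp only [hYdef, Finset.mul_sum, hEG, Finset.sum_ite_eq]
    split_ifs with h
    · rfl
    · exact (hG i h).symm
  have hXG : ∀ i, X * G i = H i * G i := by
    intro i
    rw [← hXE, mul_assoc, hEG, if_pos rfl]
  have hYH : ∀ i, Y * H i = G i * H i := by
    intro i
    rw [← hYE, mul_assoc, hEH, if_pos rfl]
  clear_value X Y
  refine finiteDimensional_of_adjoin_shift (K := K) a b E X Y hE hone hmul
    (fun i => (hXE i).trans (hEX i).symm) (fun i => (hYE i).trans (hEY i).symm) ?_ ?_
  · rw [← mul_one (X * Y), ← mul_one (Y * X), ← hone, Finset.mul_sum, Finset.mul_sum]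
    refine Finset.sum_congr rfl fun i _ => ?_
    have hYi := hYE (i - 1)
    rw [sub_add_cancel] at hYi
    rw [mul_assoc, mul_assoc, hXE, hYi, hXG, hYH, hGP]
  · rw [eq_top_iff, ← htop]
    refine Algebra.adjoin_le ?_
    have hE_mem : ∀ i, E i ∈ Algebra.adjoin K (Set.range E ∪ {X, Y}) :=
      fun i => Algebra.subset_adjoin (Or.inl ⟨i, rfl⟩)
    have hX_mem : X ∈ Algebra.adjoin K (Set.range E ∪ {X, Y}) :=
      Algebra.subset_adjoin (Or.inr (Or.inl rfl))
    have hY_mem : Y ∈ Algebra.adjoin K (Set.range E ∪ {X, Y}) :=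
      Algebra.subset_adjoin (Or.inr (Or.inr rfl))
    rintro _ ((⟨i, rfl⟩ | ⟨i, rfl⟩) | ⟨i, rfl⟩)
    · exact hE_mem i
    · rw [← hXE]
      exact mul_mem hX_mem (hE_mem i)
    · rw [← hYE]
      exact mul_mem hY_mem (hE_mem _)

/-- The preprojective algebra of type `A_{b-a+1}`, i.e. the quotient of the free algebra
by the two-sided ideal generated by the relations above, is finite-dimensional over `ℂ`. -/
theorem stmt_16 (a b : ℤ) (hab : a ≤ b) :
    FiniteDimensional ℂ (RingQuot (PPRel a b)) := by
  let π := RingQuot.mkAlgHom ℂ (PPRel a b)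
  have hπ : ∀ {x y}, PPRel a b x y → π x = π y := fun h => RingQuot.mkAlgHom_rel ℂ h
  let E : ℤ → RingQuot (PPRel a b) := fun i =>
    if h : a ≤ i ∧ i ≤ b then π (PPFree.e a b i h.1 h.2) else 0
  let H : ℤ → RingQuot (PPRel a b) := fun i =>
    if h : a ≤ i ∧ i ≤ b - 1 then π (PPFree.f a b i h.1 h.2) else 0
  let G : ℤ → RingQuot (PPRel a b) := fun i =>
    if h : a ≤ i ∧ i ≤ b - 1 then π (PPFree.g a b i h.1 h.2) else 0
  have hEpos : ∀ i (h1 : a ≤ i) (h2 : i ≤ b), E i = π (PPFree.e a b i h1 h2) :=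
    fun i h1 h2 => dif_pos ⟨h1, h2⟩
  have hHpos : ∀ i (h1 : a ≤ i) (h2 : i ≤ b - 1), H i = π (PPFree.f a b i h1 h2) :=
    fun i h1 h2 => dif_pos ⟨h1, h2⟩
  have hGpos : ∀ i (h1 : a ≤ i) (h2 : i ≤ b - 1), G i = π (PPFree.g a b i h1 h2) :=
    fun i h1 h2 => dif_pos ⟨h1, h2⟩
  have hE : ∀ i, i ∉ Finset.Icc a b → E i = 0 :=
    fun i h => dif_neg (by rwa [Finset.mem_Icc] at h)
  have hH : ∀ i, i ∉ Finset.Icc a (b - 1) → H i = 0 :=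
    fun i h => dif_neg (by rwa [Finset.mem_Icc] at h)
  have hG : ∀ i, i ∉ Finset.Icc a (b - 1) → G i = 0 :=
    fun i h => dif_neg (by rwa [Finset.mem_Icc] at h)
  refine finiteDimensional_of_preprojective_relations (K := ℂ) a b E H G hE hH hG
    ?_ ?_ ?_ ?_ ?_ ?_
  · have h := hπ (PPRel.one_eq (a := a) (b := b))
    rw [map_one, map_sum] at h
    rw [h, ← Finset.sum_attach]
    refine Finset.sum_congr rfl fun i _ => ?_
    exact hEpos _ _ _
  · intro i j
    by_cases hi : a ≤ i ∧ i ≤ b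
    · by_cases hj : a ≤ j ∧ j ≤ b
      · have h := hπ (PPRel.eps_mul i j hi.1 hi.2 hj.1 hj.2)
        rw [hEpos i hi.1 hi.2, hEpos j hj.1 hj.2, ← map_mul, h]
        split_ifs <;> simp
      · rw [hE j (by rwa [Finset.mem_Icc]), mul_zero, if_neg]
        rintro rfl
        exact hj hi
    · simp [hE i (by rwa [Finset.mem_Icc])]
  · intro i
    by_cases hi : a ≤ i ∧ i ≤ b - 1
    · have h := hπ (PPRel.arr_sandwich i hi.1 hi.2)
      rw [map_mul, map_mul] at h
      rwa [hHpos i hi.1 hi.2, hEpos i hi.1 (by omega), hEpos (i + 1) (by omega) (by omega)]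
    · simp [hH i (by rwa [Finset.mem_Icc])]
  · intro i
    by_cases hi : a ≤ i ∧ i ≤ b - 1
    · have h := hπ (PPRel.rev_sandwich i hi.1 hi.2)
      rw [map_mul, map_mul] at h
      rwa [hGpos i hi.1 hi.2, hEpos i hi.1 (by omega), hEpos (i + 1) (by omega) (by omega)]
    · simp [hG i (by rwa [Finset.mem_Icc])]
  · intro i
    rcases lt_trichotomy i a with hia | rfl | hia
    · rw [hG i (by rw [Finset.mem_Icc]; omega), hH (i - 1) (by rw [Finset.mem_Icc]; omega),
        zero_mul, zero_mul]
    · rw [hH (i - 1) (by rw [Finset.mem_Icc]; omega), zero_mul]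
      by_cases hib : i < b
      · have h := hπ (PPRel.gp_left hib)
        rwa [map_mul, map_zero, ← hGpos, ← hHpos] at h
      · rw [hG i (by rw [Finset.mem_Icc]; omega), zero_mul]
    · rcases lt_trichotomy i b with hib | rfl | hib
      · have h := hπ (PPRel.gp_mid i hia hib)
        rwa [map_mul, map_mul, ← hGpos, ← hHpos, ← hGpos, ← hHpos] at h
      · have h := hπ (PPRel.gp_right hia)
        rw [map_mul, map_zero, ← hGpos, ← hHpos] at h
        rw [h, hG i (by rw [Finset.mem_Icc]; omega), zero_mul]
      · rw [hG i (by rw [Finset.mem_Icc]; omega), hH (i - 1) (by rw [Finset.mem_Icc]; omega),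
          zero_mul, zero_mul]
  · have hsurj : Function.Surjective π := RingQuot.mkAlgHom_surjective ℂ _
    rw [eq_top_iff, ← (AlgHom.range_eq_top π).mpr hsurj, ← Algebra.map_top,
      ← FreeAlgebra.adjoin_range_ι, AlgHom.map_adjoin]
    refine Algebra.adjoin_mono ?_
    rintro _ ⟨_, ⟨x, rfl⟩, rfl⟩
    cases x with
    | eps i h1 h2 => exact Or.inl (Or.inl ⟨i, hEpos i h1 h2⟩)
    | arr i h1 h2 => exact Or.inl (Or.inr ⟨i, hHpos i h1 h2⟩)
    | rev i h1 h2 => exact Or.inr ⟨i, hGpos i h1 h2⟩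
end
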